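/- arXiv:1301.7289 — 5 statements merged into one kernel-verified Lean document; each statement's English description precedes it below -/
import Mathlib

section
/- Let ν > 0, let G have the centred Gamma distribution Γ̄_ν with density g_ν, let h : ℝ → ℝ be Lipschitz with Lipschitz constant at most 1, and set m = E[h(G)]. Define, for x > −ν, U_h(x) = (2(x+ν) g_ν(x))^{−1} ∫_{−ν}^{x} (h(y) − m) g_ν(y) dy. Then U_h is differentiable on (−ν, ∞) and solves the first-order Gamma Stein equation there: for every x > −ν, 2(x+ν) U_h'(x) − x U_h(x) = h(x) − m. -/
open MeasureTheory ProbabilityTheory Real intervalIntegral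

/-- The centred Gamma distribution `Γ̄_ν`: the law of `2 F − ν` where
`F` has the Gamma distribution with shape `ν/2` and rate `1`. -/
noncomputable def centeredGammaMeasure (ν : ℝ) : Measure ℝ :=
  (gammaMeasure (ν / 2) 1).map (fun x => 2 * x - ν)

/-- The density of the centred Gamma distribution `Γ̄_ν`. -/
noncomputable def centeredGammaPDFReal (ν x : ℝ) : ℝ :=
  if -ν < x then
    (2 : ℝ) ^ (-ν / 2) / Real.Gamma (ν / 2) * (x + ν) ^ (ν / 2 - 1) * Real.exp (-(x + ν) / 2)
  else 0

/-- The density of `Γ̄_ν` is given on `(-ν, ∞)` by its explicit formula. -/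
theorem centeredGammaPDFReal_of_lt {ν x : ℝ} (hx : -ν < x) :
    centeredGammaPDFReal ν x = (2 : ℝ) ^ (-ν / 2) / Real.Gamma (ν / 2) *
      (x + ν) ^ (ν / 2 - 1) * Real.exp (-(x + ν) / 2) :=
  if_pos hx

theorem centeredGammaPDFReal_pos {ν x : ℝ} (hν : 0 < ν) (hx : -ν < x) :
    0 < centeredGammaPDFReal ν x := by
  rw [centeredGammaPDFReal_of_lt hx]
  have hxν : 0 < x + ν := by linarith
  have hG : 0 < Real.Gamma (ν / 2) := Real.Gamma_pos_of_pos (by linarith)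
  positivity

/-- The derivative of the density of `Γ̄_ν`, expressed through its logarithmic derivative. -/
theorem hasDerivAt_centeredGammaPDFReal {ν x : ℝ} (hx : -ν < x) :
    HasDerivAt (centeredGammaPDFReal ν)
      (centeredGammaPDFReal ν x * ((ν / 2 - 1) / (x + ν) - 1 / 2)) x := by
  have hxν : 0 < x + ν := by linarith
  have hlin : HasDerivAt (fun y : ℝ => y + ν) 1 x := (hasDerivAt_id x).add_const ν
  have hpow := (hlin.rpow_const (p := ν / 2 - 1) (Or.inl hxν.ne')).const_mul
    ((2 : ℝ) ^ (-ν / 2) / Real.Gamma (ν / 2))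
  have hexp := (hlin.neg.div_const 2).exp
  have heq : centeredGammaPDFReal ν =ᶠ[nhds x] fun y =>
      (2 : ℝ) ^ (-ν / 2) / Real.Gamma (ν / 2) * (y + ν) ^ (ν / 2 - 1) *
        Real.exp (-(y + ν) / 2) := by
    filter_upwards [Ioi_mem_nhds hx] with y hy using centeredGammaPDFReal_of_lt hy
  refine ((hpow.mul hexp).congr_of_eventuallyEq heq).congr_deriv ?_
  rw [centeredGammaPDFReal_of_lt hx, Real.rpow_sub_one hxν.ne' (ν / 2 - 1)]
  simp only [Pi.neg_apply]
  field_simp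
  ring

/-- The Pearson equation `(2 (x + ν) g_ν(x))' = -x g_ν(x)` on `(-ν, ∞)`. -/
theorem hasDerivAt_two_mul_add_mul_centeredGammaPDFReal {ν x : ℝ} (hx : -ν < x) :
    HasDerivAt (fun y => 2 * (y + ν) * centeredGammaPDFReal ν y)
      (-x * centeredGammaPDFReal ν x) x := by
  have hxν : x + ν ≠ 0 := by linarith
  have hlin : HasDerivAt (fun y : ℝ => 2 * (y + ν)) (2 * 1) x :=
    ((hasDerivAt_id x).add_const ν).const_mul 2
  refine (hlin.mul (hasDerivAt_centeredGammaPDFReal hx)).congr_deriv ?_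
  field_simp
  ring

theorem intervalIntegrable_centeredGammaPDFReal {ν x : ℝ} (hν : 0 < ν) (hx : -ν < x) :
    IntervalIntegrable (centeredGammaPDFReal ν) volume (-ν) x := by
  have hpow : IntervalIntegrable (fun y : ℝ => (y + ν) ^ (ν / 2 - 1)) volume (-ν) x := by
    simpa using (intervalIntegrable_rpow' (a := 0) (b := x + ν) (r := ν / 2 - 1)
      (by linarith)).comp_add_right ν
  have hexp : Continuous fun y : ℝ => Real.exp (-(y + ν) / 2) := by fun_prop
  refine ((hpow.const_mul ((2 : ℝ) ^ (-ν / 2) / Real.Gamma (ν / 2))).mul_continuousOn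
    hexp.continuousOn).congr ?_
  intro y hy
  rw [Set.uIoc_of_le hx.le] at hy
  exact (centeredGammaPDFReal_of_lt hy.1).symm

/-- The fundamental theorem of calculus for the weight `g_ν`, based at the endpoint `-ν`. -/
theorem hasDerivAt_integral_mul_centeredGammaPDFReal {ν x : ℝ} (hν : 0 < ν) (hx : -ν < x)
    {f : ℝ → ℝ} (hf : Continuous f) :
    HasDerivAt (fun u => ∫ y in (-ν)..u, f y * centeredGammaPDFReal ν y)
      (f x * centeredGammaPDFReal ν x) x := by
  have hcont : ContinuousOn (fun y => f y * centeredGammaPDFReal ν y) (Set.Ioi (-ν)) :=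
    hf.continuousOn.mul fun y hy =>
      (hasDerivAt_centeredGammaPDFReal hy).continuousAt.continuousWithinAt
  exact integral_hasDerivAt_right
    ((intervalIntegrable_centeredGammaPDFReal hν hx).continuousOn_mul hf.continuousOn)
    (hcont.stronglyMeasurableAtFilter isOpen_Ioi x hx)
    (hcont.continuousAt (Ioi_mem_nhds hx))

/-- Let `ν > 0`, `h : ℝ → ℝ` be `1`-Lipschitz and `m = E[h(G)]` where `G` has
the centred Gamma distribution `Γ̄_ν` with density `g_ν`.  Then the function
`U_h(x) = (2(x+ν) g_ν(x))⁻¹ ∫_{−ν}^{x} (h(y) − m) g_ν(y) dy` is differentiable on `(−ν, ∞)` and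
solves the first-order Gamma Stein equation there:
`2(x+ν) U_h'(x) − x U_h(x) = h(x) − m` for every `x > −ν`. -/
theorem steinSolution_solves_steinEquation
    (ν : ℝ) (hν : 0 < ν) (h : ℝ → ℝ) (hLip : LipschitzWith 1 h)
    (m : ℝ) (hm : m = ∫ x, h x ∂(centeredGammaMeasure ν))
    (U : ℝ → ℝ)
    (hU : ∀ x, -ν < x →
      U x = (2 * (x + ν) * centeredGammaPDFReal ν x)⁻¹
              * ∫ y in (-ν)..x, (h y - m) * centeredGammaPDFReal ν y) :
    ∀ x, -ν < x →
      DifferentiableAt ℝ U x ∧ 2 * (x + ν) * deriv U x - x * U x = h x - m := by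
  intro x hx
  have hxν : 0 < x + ν := by linarith
  have hg := centeredGammaPDFReal_pos hν hx
  have hw : 2 * (x + ν) * centeredGammaPDFReal ν x ≠ 0 := by positivity
  have hderiv := ((hasDerivAt_two_mul_add_mul_centeredGammaPDFReal hx).fun_inv hw).fun_mul
    (hasDerivAt_integral_mul_centeredGammaPDFReal hν hx (f := fun y => h y - m)
      (hLip.continuous.sub continuous_const))
  have heq : U =ᶠ[nhds x] fun u => (2 * (u + ν) * centeredGammaPDFReal ν u)⁻¹
      * ∫ y in (-ν)..u, (h y - m) * centeredGammaPDFReal ν y := by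
    filter_upwards [Ioi_mem_nhds hx] with u hu using hU u hu
  have hUderiv := hderiv.congr_of_eventuallyEq heq
  refine ⟨hUderiv.differentiableAt, ?_⟩
  rw [hUderiv.deriv, hU x hx]
  field_simp
  ring
end

section
/- Let ν > 0, let G have the centred Gamma distribution Γ̄_ν, and let h : ℝ → ℝ be differentiable with |h'(x)| ≤ 1 for all x. Set m = E[h(G)] and u(x) = −(h(x) − m)/x for x < 0. Then u is differentiable on (−∞, −ν] and for every x ≤ −ν one has |u'(x)| ≤ 2/(−x) ≤ 2/ν. -/
open MeasureTheory ProbabilityTheory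

/-- Multiplying a Gamma density by the identity raises the shape parameter by one. -/
lemma gammaPDFReal_mul_self {a r : ℝ} (ha : 0 < a) (hr : 0 < r) (x : ℝ) :
    gammaPDFReal a r x * x = a / r * gammaPDFReal (a + 1) r x := by
  unfold gammaPDFReal
  split_ifs with hx
  · have hx_pow : x ^ (a + 1 - 1) = x ^ (a - 1) * x := by
      rcases hx.eq_or_lt with rfl | hx
      · simp [ha.ne']
      · rw [← Real.rpow_add_one hx.ne']
        ring_nf
    have hGamma := (Real.Gamma_pos_of_pos ha).ne'
    rw [hx_pow, Real.Gamma_add_one ha.ne', Real.rpow_add_one hr.ne']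
    field_simp
  · simp

lemma toReal_gammaPDF {a r : ℝ} (ha : 0 < a) (hr : 0 < r) (x : ℝ) :
    (gammaPDF a r x).toReal = gammaPDFReal a r x :=
  ENNReal.toReal_ofReal (gammaPDFReal_nonneg ha hr x)

lemma measurable_gammaPDF (a r : ℝ) : Measurable (gammaPDF a r) :=
  (measurable_gammaPDFReal a r).ennreal_ofReal

lemma integral_gammaPDFReal_eq_one {a r : ℝ} (ha : 0 < a) (hr : 0 < r) :
    ∫ x, gammaPDFReal a r x = 1 := by
  rw [integral_eq_lintegral_of_nonneg_ae (ae_of_all _ (gammaPDFReal_nonneg ha hr))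
    (by fun_prop)]
  exact (ENNReal.toReal_eq_one_iff _).2 (lintegral_gammaPDF_eq_one ha hr)

lemma integrable_id_gammaMeasure {a r : ℝ} (ha : 0 < a) (hr : 0 < r) :
    Integrable (fun x => x) (gammaMeasure a r) := by
  rw [gammaMeasure, integrable_withDensity_iff_integrable_smul' (measurable_gammaPDF a r)
    (ae_of_all _ fun _ => ENNReal.ofReal_lt_top)]
  simp_rw [toReal_gammaPDF ha hr, smul_eq_mul, gammaPDFReal_mul_self ha hr]
  exact (integrable_of_integral_eq_one
    (integral_gammaPDFReal_eq_one (by positivity) hr)).const_mul _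

lemma integral_id_gammaMeasure {a r : ℝ} (ha : 0 < a) (hr : 0 < r) :
    ∫ x, x ∂(gammaMeasure a r) = a / r := by
  rw [gammaMeasure, integral_withDensity_eq_integral_toReal_smul (measurable_gammaPDF a r)
    (ae_of_all _ fun _ => ENNReal.ofReal_lt_top)]
  simp_rw [toReal_gammaPDF ha hr, smul_eq_mul, gammaPDFReal_mul_self ha hr]
  rw [integral_const_mul, integral_gammaPDFReal_eq_one (by positivity) hr, mul_one]

lemma ae_nonneg_gammaMeasure (a r : ℝ) : ∀ᵐ x ∂(gammaMeasure a r), 0 ≤ x := by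
  rw [gammaMeasure, ae_withDensity_iff (measurable_gammaPDF a r)]
  refine ae_of_all _ fun x hx => ?_
  contrapose! hx
  exact gammaPDF_of_neg hx

section CenteredGamma

variable {ν : ℝ}

lemma isProbabilityMeasure_centeredGammaMeasure (hν : 0 < ν) :
    IsProbabilityMeasure (centeredGammaMeasure ν) := by
  have := isProbabilityMeasure_gammaMeasure (half_pos hν) one_pos
  exact Measure.isProbabilityMeasure_map (by fun_prop)

lemma integrable_id_centeredGammaMeasure (hν : 0 < ν) :
    Integrable (fun x => x) (centeredGammaMeasure ν) := by
  have := isProbabilityMeasure_gammaMeasure (half_pos hν) one_pos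
  rw [centeredGammaMeasure, integrable_map_measure (by fun_prop) (by fun_prop)]
  exact ((integrable_id_gammaMeasure (half_pos hν) one_pos).const_mul 2).sub
    (integrable_const ν)

lemma integral_id_centeredGammaMeasure (hν : 0 < ν) :
    ∫ x, x ∂(centeredGammaMeasure ν) = 0 := by
  have := isProbabilityMeasure_gammaMeasure (half_pos hν) one_pos
  rw [centeredGammaMeasure, integral_map (by fun_prop) (by fun_prop),
    integral_sub ((integrable_id_gammaMeasure (half_pos hν) one_pos).const_mul 2)
      (integrable_const ν), integral_const_mul, integral_id_gammaMeasure (half_pos hν) one_pos]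
  simp
  ring

lemma ae_neg_le_centeredGammaMeasure (ν : ℝ) :
    ∀ᵐ x ∂(centeredGammaMeasure ν), -ν ≤ x := by
  rw [centeredGammaMeasure, ae_map_iff (by fun_prop) measurableSet_Ici]
  filter_upwards [ae_nonneg_gammaMeasure (ν / 2) 1] with x hx
  linarith

/-- To the left of the support of `Γ̄_ν`, a `1`-Lipschitz function differs from its mean by at
most the distance to the mean `0` of `Γ̄_ν`. -/
lemma abs_sub_integral_centeredGammaMeasure_le (hν : 0 < ν) {h : ℝ → ℝ} (hh : LipschitzWith 1 h)
    {x : ℝ} (hx : x ≤ -ν) : |h x - ∫ y, h y ∂(centeredGammaMeasure ν)| ≤ -x := by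
  have := isProbabilityMeasure_centeredGammaMeasure hν
  have hid := integrable_id_centeredGammaMeasure hν
  have hdist (y : ℝ) : |h x - h y| ≤ |x - y| := by
    simpa [Real.dist_eq] using hh.dist_le_mul x y
  have hsub : Integrable (fun y => h x - h y) (centeredGammaMeasure ν) :=
    ((integrable_const x).sub hid).mono
      (continuous_const.sub hh.continuous).aestronglyMeasurable (ae_of_all _ hdist)
  have hint : Integrable h (centeredGammaMeasure ν) := by
    refine ((integrable_const (h x)).sub hsub).congr (ae_of_all _ fun y => ?_)
    simp
  calc |h x - ∫ y, h y ∂(centeredGammaMeasure ν)|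
      = |∫ y, (h x - h y) ∂(centeredGammaMeasure ν)| := by
        rw [integral_sub (integrable_const _) hint]
        simp
    _ ≤ ∫ y, |h x - h y| ∂(centeredGammaMeasure ν) := abs_integral_le_integral_abs
    _ ≤ ∫ y, (y - x) ∂(centeredGammaMeasure ν) := by
        refine integral_mono_ae hsub.abs (hid.sub (integrable_const x)) ?_
        filter_upwards [ae_neg_le_centeredGammaMeasure ν] with y hy
        refine (hdist y).trans_eq ?_
        rw [abs_sub_comm, abs_of_nonneg (by linarith)]
    _ = -x := by
        rw [integral_sub hid (integrable_const x), integral_id_centeredGammaMeasure hν]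
        simp

end CenteredGamma

/-- Let `ν > 0`, let `G ∼ Γ̄_ν`, let `h : ℝ → ℝ` be differentiable with
`|h'| ≤ 1`, set `m = E[h(G)]` and `u(x) = −(h(x) − m)/x` for `x < 0`.  Then `u` is
differentiable on `(−∞, −ν]` and for every `x ≤ −ν` one has `|u'(x)| ≤ 2/(−x) ≤ 2/ν`. -/
theorem steinSolution_left_branch_deriv_bound
    (ν : ℝ) (hν : 0 < ν) (h : ℝ → ℝ)
    (hdiff : Differentiable ℝ h) (hderiv : ∀ x, |deriv h x| ≤ 1)
    (m : ℝ) (hm : m = ∫ x, h x ∂(centeredGammaMeasure ν))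
    (u : ℝ → ℝ) (hu : ∀ x, x < 0 → u x = -(h x - m) / x) :
    ∀ x, x ≤ -ν →
      DifferentiableAt ℝ u x ∧ |deriv u x| ≤ 2 / (-x) ∧ 2 / (-x) ≤ 2 / ν := by
  intro x hx
  have hx_neg : x < 0 := by linarith
  have hlip : LipschitzWith 1 h := lipschitzWith_of_nnnorm_deriv_le hdiff hderiv
  have hbound : |h x - m| ≤ -x := hm ▸ abs_sub_integral_centeredGammaMeasure_le hν hlip hx
  have hu_deriv : HasDerivAt u ((-deriv h x * x - -(h x - m) * 1) / x ^ 2) x := by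
    refine HasDerivAt.congr_of_eventuallyEq
      ((((hdiff x).hasDerivAt.sub_const m).neg).div (hasDerivAt_id x) hx_neg.ne) ?_
    filter_upwards [Iio_mem_nhds hx_neg] with y hy using hu y hy
  refine ⟨hu_deriv.differentiableAt, ?_, ?_⟩
  · rw [hu_deriv.deriv, abs_div, abs_of_pos (sq_pos_of_neg hx_neg),
      div_le_div_iff₀ (sq_pos_of_neg hx_neg) (by linarith)]
    have hnum : |-deriv h x * x - -(h x - m) * 1| ≤ 2 * -x := by
      calc |-deriv h x * x - -(h x - m) * 1|
          = |deriv h x * -x + (h x - m)| := by ring_nf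
        _ ≤ |deriv h x * -x| + |h x - m| := abs_add_le _ _
        _ ≤ 1 * -x + -x := by
            rw [abs_mul, abs_of_pos (neg_pos.2 hx_neg)]
            gcongr
            · linarith
            · exact hderiv x
        _ = 2 * -x := by ring
    calc |-deriv h x * x - -(h x - m) * 1| * -x ≤ 2 * -x * -x := by
          gcongr
          linarith
      _ = 2 * x ^ 2 := by ring
  · gcongr
    linarith
end

section
/- Let ν > 0, let G have the centred Gamma distribution Γ̄_ν, and let f : ℝ → ℝ be continuously differentiable with both f and f' bounded. Then E[2(G+ν) f'(G) − G f(G)] = 0; that is, the first-order Stein operator Tf(x) = 2(x+ν)₊ f'(x) − x f(x) annihilates Γ̄_ν in expectation. -/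
open MeasureTheory ProbabilityTheory

open Set Filter Topology

/-- Integration against the Gamma distribution, written with its density on `(0, ∞)`. -/
lemma integral_gammaMeasure {a r : ℝ} (ha : 0 < a) (hr : 0 < r) (g : ℝ → ℝ) :
    ∫ x, g x ∂(gammaMeasure a r) =
      r ^ a / Real.Gamma a * ∫ x in Ioi 0, x ^ (a - 1) * Real.exp (-r * x) * g x := by
  have hmeas : Measurable (gammaPDF a r) := (measurable_gammaPDFReal a r).ennreal_ofReal
  have hlt : ∀ᵐ x ∂volume, gammaPDF a r x < ⊤ :=
    Eventually.of_forall fun _ ↦ ENNReal.ofReal_lt_top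
  rw [gammaMeasure, integral_withDensity_eq_integral_toReal_smul hmeas hlt,
    ← setIntegral_eq_integral_of_forall_compl_eq_zero (s := Ici 0), integral_Ici_eq_integral_Ioi,
    ← integral_const_mul]
  · refine setIntegral_congr_fun measurableSet_Ioi fun x hx ↦ ?_
    rw [gammaPDF, ENNReal.toReal_ofReal (gammaPDFReal_nonneg ha hr x), gammaPDFReal,
      if_pos (le_of_lt hx), smul_eq_mul, neg_mul]
    ring
  · intro x hx
    rw [gammaPDF_of_neg (not_le.mp hx), ENNReal.toReal_zero, zero_smul]

lemma integrableOn_rpow_mul_exp_neg_mul_mul {s r C : ℝ} (hs : -1 < s) (hr : 0 < r) {g : ℝ → ℝ}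
    (hg : Continuous g) (hgb : ∀ x, |g x| ≤ C) :
    IntegrableOn (fun x ↦ x ^ s * Real.exp (-r * x) * g x) (Ioi 0) := by
  have h := integrableOn_rpow_mul_exp_neg_mul_rpow hs one_pos hr
  simp only [Real.rpow_one] at h
  exact Integrable.mul_bdd (c := C) h hg.aestronglyMeasurable (Eventually.of_forall hgb)

/-- The first-order Stein identity for the Gamma distribution. -/
lemma integral_stein_gammaMeasure {a r : ℝ} (ha : 0 < a) (hr : 0 < r) {h : ℝ → ℝ}
    (hh : ContDiff ℝ 1 h) (hb : ∃ C, ∀ x, |h x| ≤ C) (hb' : ∃ C, ∀ x, |deriv h x| ≤ C) :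
    ∫ x, (x * deriv h x + (a - r * x) * h x) ∂(gammaMeasure a r) = 0 := by
  obtain ⟨C, hC⟩ := hb
  obtain ⟨C', hC'⟩ := hb'
  have hderiv : ∀ x ∈ Ioi (0 : ℝ), HasDerivAt (fun x ↦ x ^ a * Real.exp (-r * x) * h x)
      (x ^ (a - 1) * Real.exp (-r * x) * (x * deriv h x + (a - r * x) * h x)) x := by
    intro x hx
    have hx0 : x ≠ 0 := ne_of_gt hx
    have h1 := Real.hasDerivAt_rpow_const (x := x) (p := a) (Or.inl hx0)
    have h2 := ((hasDerivAt_id x).const_mul (-r)).exp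
    have h3 := (hh.differentiable one_ne_zero x).hasDerivAt
    refine ((h1.mul h2).mul h3).congr_deriv ?_
    have hxa : x ^ a = x ^ (a - 1) * x := by rw [Real.rpow_sub_one hx0, div_mul_cancel₀ _ hx0]
    simp only [id, hxa, Pi.mul_apply]
    ring
  have hint : IntegrableOn (fun x ↦ x ^ (a - 1) * Real.exp (-r * x) *
      (x * deriv h x + (a - r * x) * h x)) (Ioi 0) := by
    have i1 := integrableOn_rpow_mul_exp_neg_mul_mul (by linarith : -1 < a) hr
      (hh.continuous_deriv le_rfl) hC'
    have i2 := integrableOn_rpow_mul_exp_neg_mul_mul (by linarith : -1 < a) hr hh.continuous hC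
    have i3 := integrableOn_rpow_mul_exp_neg_mul_mul (by linarith : -1 < a - 1) hr hh.continuous hC
    refine ((i1.add (i3.const_mul a)).sub (i2.const_mul r)).congr_fun (fun x hx ↦ ?_)
      measurableSet_Ioi
    have hx0 : x ≠ 0 := ne_of_gt hx
    have hxa : x ^ a = x ^ (a - 1) * x := by rw [Real.rpow_sub_one hx0, div_mul_cancel₀ _ hx0]
    simp only [Pi.add_apply, Pi.sub_apply, hxa]
    ring
  have hcont : ContinuousWithinAt (fun x ↦ x ^ a * Real.exp (-r * x) * h x) (Ici 0) 0 := by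
    have := Real.continuous_rpow_const ha.le
    have := hh.continuous
    exact Continuous.continuousWithinAt (by fun_prop)
  have htend : Tendsto (fun x ↦ x ^ a * Real.exp (-r * x) * h x) atTop (𝓝 0) :=
    (tendsto_rpow_mul_exp_neg_mul_atTop_nhds_zero a r hr).zero_mul_isBoundedUnder_le
      (isBoundedUnder_of ⟨C, hC⟩)
  rw [integral_gammaMeasure ha hr, integral_Ioi_of_hasDerivAt_of_tendsto hcont hderiv hint htend,
    Real.zero_rpow ha.ne']
  ring

/-- Let `ν > 0`, let `G` have the centred Gamma distribution `Γ̄_ν`, and let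
`f : ℝ → ℝ` be continuously differentiable with both `f` and `f'` bounded.  Then
`E[2(G+ν) f'(G) − G f(G)] = 0`: the first-order Stein operator annihilates `Γ̄_ν`
in expectation. -/
theorem steinOperator_annihilates_centeredGamma
    (ν : ℝ) (hν : 0 < ν) (f : ℝ → ℝ) (hf : ContDiff ℝ 1 f)
    (hfb : ∃ C, ∀ x, |f x| ≤ C) (hfb' : ∃ C, ∀ x, |deriv f x| ≤ C) :
    ∫ x, (2 * (x + ν) * deriv f x - x * f x) ∂(centeredGammaMeasure ν) = 0 := by
  have hf_cont := hf.continuous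
  have hf'_cont := hf.continuous_deriv le_rfl
  have hderiv : ∀ y, deriv (fun y ↦ f (2 * y - ν)) y = 2 * deriv f (2 * y - ν) := fun y ↦ by
    have h2 : HasDerivAt (fun y : ℝ ↦ 2 * y - ν) 2 y := by
      simpa using ((hasDerivAt_id y).const_mul 2).sub_const ν
    have h1 := (hf.differentiable one_ne_zero (2 * y - ν)).hasDerivAt
    rw [mul_comm]
    exact (h1.comp y h2).deriv
  obtain ⟨C, hC⟩ := hfb
  obtain ⟨C', hC'⟩ := hfb'
  have key := integral_stein_gammaMeasure (half_pos hν) one_pos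
    (h := fun y ↦ f (2 * y - ν)) (hf.comp (by fun_prop)) ⟨C, fun _ ↦ hC _⟩
    ⟨2 * C', fun y ↦ by rw [hderiv, abs_mul, abs_two]; gcongr; exact hC' _⟩
  rw [centeredGammaMeasure, integral_map (by fun_prop)
    (Continuous.aestronglyMeasurable (by fun_prop)), ← mul_zero (2 : ℝ), ← key,
    ← integral_const_mul]
  congr 1 with y
  rw [hderiv]
  ring
end

section
/- Let ν > 0 and c₁, c₂ ≥ 0. Let f₁, f₂ : ℝ → ℝ be twice differentiable with |fᵢ'(x)| ≤ c₁ and |fᵢ''(x)| ≤ c₂ for all x ∈ ℝ and i = 1, 2, and with f₁(−ν) = f₂(−ν). Define f(x) = f₁(x) for x ≤ −ν and f(x) = f₂(x) for x > −ν, and define g(x) = f₁'(x) for x ≤ −ν and g(x) = f₂'(x) for x > −ν. Then for all x, Δ ∈ ℝ: |f(x+Δ) − f(x) − g(x)·Δ| ≤ c₂Δ² + 2c₁|Δ|·(1{x ≤ −ν < x+Δ} + 1{x+Δ ≤ −ν < x}), where 1{·} denotes the indicator of the stated event. -/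
theorem abs_sub_le_of_abs_deriv_le {h : ℝ → ℝ} {c : ℝ} (hd : Differentiable ℝ h)
    (hb : ∀ x, |deriv h x| ≤ c) (x y : ℝ) : |h y - h x| ≤ c * |y - x| :=
  convex_univ.norm_image_sub_le_of_norm_deriv_le (fun z _ => hd z) (fun z _ => hb z)
    (Set.mem_univ x) (Set.mem_univ y)

theorem abs_sub_sub_deriv_mul_le {h : ℝ → ℝ} {c : ℝ} (hc : 0 ≤ c) (hd : Differentiable ℝ h)
    (hd' : Differentiable ℝ (deriv h)) (hb : ∀ x, |deriv (deriv h) x| ≤ c) (x Δ : ℝ) :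
    |h (x + Δ) - h x - deriv h x * Δ| ≤ c * Δ ^ 2 := by
  have key := (convex_uIcc x (x + Δ)).norm_image_sub_le_of_norm_hasDerivWithin_le
    (f := fun z => h z - deriv h x * z) (f' := fun z => deriv h z - deriv h x) (C := c * |Δ|)
    (fun z _ => by
      simpa using ((hd z).hasDerivAt.fun_sub
        ((hasDerivAt_id z).const_mul (deriv h x))).hasDerivWithinAt)
    (fun z hz => (abs_sub_le_of_abs_deriv_le hd' hb x z).trans <| by
      have := Set.abs_sub_left_of_mem_uIcc hz
      rw [add_sub_cancel_left] at this
      gcongr)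
    Set.left_mem_uIcc Set.right_mem_uIcc
  rw [Real.norm_eq_abs, Real.norm_eq_abs, add_sub_cancel_left, mul_assoc, abs_mul_abs_self] at key
  calc |h (x + Δ) - h x - deriv h x * Δ|
      = |h (x + Δ) - deriv h x * (x + Δ) - (h x - deriv h x * x)| := by ring_nf
    _ ≤ c * (Δ * Δ) := key
    _ = c * Δ ^ 2 := by ring

/-- Across a point `a` between `x` and `x + Δ` at which `h` and `k` agree, only the first-derivative
bounds are available. -/
theorem abs_sub_sub_deriv_mul_le_of_eq {h k : ℝ → ℝ} {a c : ℝ}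
    (hh : Differentiable ℝ h) (hk : Differentiable ℝ k)
    (hbh : ∀ x, |deriv h x| ≤ c) (hbk : ∀ x, |deriv k x| ≤ c) (hak : h a = k a) {x Δ : ℝ}
    (ha : |x + Δ - a| + |a - x| = |Δ|) :
    |k (x + Δ) - h x - deriv h x * Δ| ≤ 2 * c * |Δ| := by
  have hk' := abs_sub_le_of_abs_deriv_le hk hbk a (x + Δ)
  have hh' := abs_sub_le_of_abs_deriv_le hh hbh x a
  have hm : |deriv h x * Δ| ≤ c * |Δ| := by
    rw [abs_mul]
    exact mul_le_mul_of_nonneg_right (hbh x) (abs_nonneg Δ)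
  calc |k (x + Δ) - h x - deriv h x * Δ|
      = |(k (x + Δ) - k a) + (h a - h x) - deriv h x * Δ| := by rw [hak]; ring_nf
    _ ≤ |k (x + Δ) - k a| + |h a - h x| + |deriv h x * Δ| :=
      (abs_sub _ _).trans (by gcongr; exact abs_add_le _ _)
    _ ≤ c * |x + Δ - a| + c * |a - x| + c * |Δ| := by gcongr
    _ = 2 * c * |Δ| := by rw [← mul_add, ha]; ring

/-- Pointwise Taylor-type estimate with a boundary-crossing term for a
function glued at `−ν` from two twice differentiable pieces with `|fᵢ'| ≤ c₁` and
`|fᵢ''| ≤ c₂`, the derivative at the gluing point being the left derivative. -/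
theorem piecewise_taylor_estimate
    (ν c₁ c₂ : ℝ) (hν : 0 < ν) (hc₁ : 0 ≤ c₁) (hc₂ : 0 ≤ c₂)
    (f₁ f₂ : ℝ → ℝ)
    (hd₁ : Differentiable ℝ f₁) (hd₁' : Differentiable ℝ (deriv f₁))
    (hd₂ : Differentiable ℝ f₂) (hd₂' : Differentiable ℝ (deriv f₂))
    (hb₁ : ∀ x, |deriv f₁ x| ≤ c₁) (hb₁' : ∀ x, |deriv (deriv f₁) x| ≤ c₂)
    (hb₂ : ∀ x, |deriv f₂ x| ≤ c₁) (hb₂' : ∀ x, |deriv (deriv f₂) x| ≤ c₂)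
    (hglue : f₁ (-ν) = f₂ (-ν))
    (f g : ℝ → ℝ)
    (hf : ∀ x, f x = if x ≤ -ν then f₁ x else f₂ x)
    (hg : ∀ x, g x = if x ≤ -ν then deriv f₁ x else deriv f₂ x) :
    ∀ x Δ : ℝ,
      |f (x + Δ) - f x - g x * Δ| ≤
        c₂ * Δ ^ 2 +
          2 * c₁ * |Δ| *
            ((if x ≤ -ν ∧ -ν < x + Δ then (1 : ℝ) else 0) +
              (if x + Δ ≤ -ν ∧ -ν < x then (1 : ℝ) else 0)) := by
  intro x Δ
  have hΔ : 0 ≤ c₂ * Δ ^ 2 := by positivity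
  rw [hf, hf, hg]
  by_cases hx : x ≤ -ν <;> by_cases hy : x + Δ ≤ -ν
  · have := abs_sub_sub_deriv_mul_le hc₂ hd₁ hd₁' hb₁' x Δ
    simpa [hx, hy, hx.not_gt, hy.not_gt] using this
  · have := abs_sub_sub_deriv_mul_le_of_eq hd₁ hd₂ hb₁ hb₂ hglue (x := x) (Δ := Δ) (by
      rw [abs_of_nonneg (by linarith), abs_of_nonneg (by linarith), abs_of_nonneg (by linarith)]
      ring)
    simp only [hx, hy, not_le.mp hy, and_self, false_and, if_true, if_false]
    linarith
  · have := abs_sub_sub_deriv_mul_le_of_eq hd₂ hd₁ hb₂ hb₁ hglue.symm (x := x) (Δ := Δ) (by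
      rw [abs_of_nonpos (by linarith), abs_of_nonpos (by linarith), abs_of_nonpos (by linarith)]
      ring)
    simp only [hx, hy, not_le.mp hx, and_self, false_and, if_true, if_false]
    linarith
  · have := abs_sub_sub_deriv_mul_le hc₂ hd₂ hd₂' hb₂' x Δ
    simpa only [hx, hy, false_and, if_false, add_zero, mul_zero] using this
end

section
/- Let Y and X_n (n ≥ 1) be integrable real random variables such that d₃(X_n, Y) → 0 as n → ∞. Then the law of X_n converges weakly to the law of Y; that is, the topology induced by the pseudo-metric d₃ is stronger than the topology of convergence in distribution. -/
open MeasureTheory Filter Topology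

/-- The class `ℋ³` of three-times differentiable functions `h : ℝ → ℝ` whose derivatives of
orders 1, 2, 3 are bounded in absolute value by 1. -/
def H3 : Set (ℝ → ℝ) :=
  {h | Differentiable ℝ h ∧ Differentiable ℝ (deriv h) ∧ Differentiable ℝ (deriv (deriv h)) ∧
    (∀ x, |deriv h x| ≤ 1) ∧ (∀ x, |deriv (deriv h) x| ≤ 1) ∧
    (∀ x, |deriv (deriv (deriv h)) x| ≤ 1)}

/-- The pseudo-distance `d₃(X,Y) = sup_{h ∈ ℋ³} |E[h(X)] − E[h(Y)]|`. -/
noncomputable def d3 {Ω Ω' : Type*} [MeasurableSpace Ω] [MeasurableSpace Ω']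
    (μ : Measure Ω) (μ' : Measure Ω') (X : Ω → ℝ) (Y : Ω' → ℝ) : ℝ :=
  sSup {d | ∃ h ∈ H3, d = |(∫ ω, h (X ω) ∂μ) - ∫ ω, h (Y ω) ∂μ'|}

theorem deriv_const_mul_cos_affine (c t a : ℝ) :
    deriv (fun x => c * Real.cos (t * x + a)) =
      fun x => c * t * Real.cos (t * x + (a + Real.pi / 2)) := by
  funext x
  have h : HasDerivAt (fun x => c * Real.cos (t * x + a))
      (c * (-Real.sin (t * x + a) * (t * 1))) x :=
    ((((hasDerivAt_id x).const_mul t).add_const a).cos).const_mul c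
  rw [h.deriv, ← add_assoc, Real.cos_add_pi_div_two]
  ring

/-- A sufficiently small multiple of a cosine wave belongs to `ℋ³`. -/
theorem const_mul_cos_affine_mem_H3 (t a : ℝ) :
    (fun x => ((1 + |t|) ^ 3)⁻¹ * Real.cos (t * x + a)) ∈ H3 := by
  have hdiff (c b : ℝ) : Differentiable ℝ (fun x => c * Real.cos (t * x + b)) := by fun_prop
  have hbound (k : ℕ) (hk : k ≤ 3) (y : ℝ) :
      |((1 + |t|) ^ 3)⁻¹ * t ^ k * Real.cos y| ≤ 1 := by
    have hpow : |t| ^ k ≤ (1 + |t|) ^ 3 :=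
      (pow_le_pow_left₀ (abs_nonneg t) (by linarith) k).trans
        (pow_le_pow_right₀ (by linarith [abs_nonneg t]) hk)
    have hcoef : |((1 + |t|) ^ 3)⁻¹ * t ^ k| ≤ 1 := by
      rw [abs_mul, abs_pow, abs_of_pos (by positivity : 0 < ((1 + |t|) ^ 3)⁻¹)]
      exact inv_mul_le_one_of_le₀ hpow (by positivity)
    rw [abs_mul]
    exact mul_le_one₀ hcoef (abs_nonneg _) (Real.abs_cos_le_one y)
  simp only [H3, Set.mem_ofPred_eq, deriv_const_mul_cos_affine]
  refine ⟨hdiff _ _, hdiff _ _, hdiff _ _, fun x => ?_, fun x => ?_, fun x => ?_⟩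
  · simpa only [pow_one] using hbound 1 (by norm_num) (t * x + (a + Real.pi / 2))
  · simpa only [pow_two, mul_assoc] using
      hbound 2 (by norm_num) (t * x + (a + Real.pi / 2 + Real.pi / 2))
  · simpa only [pow_succ, pow_zero, one_mul, mul_assoc] using
      hbound 3 (by norm_num) (t * x + (a + Real.pi / 2 + Real.pi / 2 + Real.pi / 2))

theorem lipschitzWith_one_of_mem_H3 {h : ℝ → ℝ} (hh : h ∈ H3) : LipschitzWith 1 h :=
  lipschitzWith_of_nnnorm_deriv_le hh.1 fun x => by
    rw [← NNReal.coe_le_coe]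
    simpa using hh.2.2.2.1 x

theorem LipschitzWith.integrable_comp_real {Ω : Type*} [MeasurableSpace Ω] {P : Measure Ω}
    [IsFiniteMeasure P] {h : ℝ → ℝ} {K : NNReal} (hh : LipschitzWith K h) {X : Ω → ℝ}
    (hX : Integrable X P) : Integrable (fun ω => h (X ω)) P := by
  refine ((integrable_const |h 0|).add (hX.abs.const_mul K)).mono'
    (hh.continuous.comp_aestronglyMeasurable hX.aestronglyMeasurable) (ae_of_all _ fun ω => ?_)
  have hlip : |h (X ω) - h 0| ≤ K * |X ω| := by
    simpa [Real.dist_eq] using hh.dist_le_mul (X ω) 0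
  have htri : |h (X ω)| ≤ |h (X ω) - h 0| + |h 0| := by
    simpa using abs_add_le (h (X ω) - h 0) (h 0)
  simp only [Real.norm_eq_abs, Pi.add_apply]
  linarith

theorem abs_integral_sub_le_d3 {Ω : Type*} [MeasurableSpace Ω] {P : Measure Ω}
    [IsFiniteMeasure P] {X Y : Ω → ℝ} (hX : Integrable X P) (hY : Integrable Y P)
    {h : ℝ → ℝ} (hh : h ∈ H3) :
    |(∫ ω, h (X ω) ∂P) - ∫ ω, h (Y ω) ∂P| ≤ d3 P P X Y := by
  refine le_csSup ⟨∫ ω, |X ω - Y ω| ∂P, ?_⟩ ⟨h, hh, rfl⟩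
  rintro _ ⟨g, hg, rfl⟩
  have hlip := lipschitzWith_one_of_mem_H3 hg
  have hgX := hlip.integrable_comp_real hX
  have hgY := hlip.integrable_comp_real hY
  rw [← integral_sub hgX hgY]
  refine abs_integral_le_integral_abs.trans
    (integral_mono (hgX.sub hgY).abs (hX.sub hY).abs fun ω => ?_)
  simpa [Real.dist_eq] using hlip.dist_le_mul (X ω) (Y ω)

theorem tendsto_integral_cos_of_tendsto_d3 {Ω : Type*} [MeasurableSpace Ω] {P : Measure Ω}
    [IsFiniteMeasure P] {X : ℕ → Ω → ℝ} {Y : Ω → ℝ}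
    (hX : ∀ n, Integrable (X n) P) (hY : Integrable Y P)
    (hconv : Tendsto (fun n => d3 P P (X n) Y) atTop (𝓝 0)) (t a : ℝ) :
    Tendsto (fun n => ∫ ω, Real.cos (t * X n ω + a) ∂P) atTop
      (𝓝 (∫ ω, Real.cos (t * Y ω + a) ∂P)) := by
  have hlim : Tendsto (fun n => ∫ ω, ((1 + |t|) ^ 3)⁻¹ * Real.cos (t * X n ω + a) ∂P) atTop
      (𝓝 (∫ ω, ((1 + |t|) ^ 3)⁻¹ * Real.cos (t * Y ω + a) ∂P)) := by
    rw [tendsto_iff_dist_tendsto_zero]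
    exact squeeze_zero (fun n => dist_nonneg)
      (fun n => abs_integral_sub_le_d3 (hX n) hY (const_mul_cos_affine_mem_H3 t a)) hconv
  have hne : (1 + |t|) ^ 3 ≠ 0 := by positivity
  have hcancel (Z : Ω → ℝ) : (1 + |t|) ^ 3 *
      ∫ ω, ((1 + |t|) ^ 3)⁻¹ * Real.cos (t * Z ω + a) ∂P = ∫ ω, Real.cos (t * Z ω + a) ∂P := by
    rw [integral_const_mul]
    exact mul_inv_cancel_left₀ hne _
  rw [← hcancel Y]
  exact (hlim.const_mul ((1 + |t|) ^ 3)).congr fun n => hcancel (X n)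

theorem charFun_map_eq_integral_cos {Ω : Type*} [MeasurableSpace Ω] {P : Measure Ω}
    [IsFiniteMeasure P] {X : Ω → ℝ} (hX : AEMeasurable X P) (t : ℝ) :
    charFun (P.map X) t =
      ((∫ ω, Real.cos (t * X ω + 0) ∂P : ℝ) : ℂ) +
        ((∫ ω, Real.cos (t * X ω + -(Real.pi / 2)) ∂P : ℝ) : ℂ) * Complex.I := by
  have hint (a : ℝ) : Integrable (fun ω => (Real.cos (t * X ω + a) : ℂ)) P := by
    refine Integrable.ofReal (Integrable.of_bound (C := 1) ?_ (ae_of_all _ fun ω => ?_))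
    · exact (Real.measurable_cos.comp_aemeasurable
        ((hX.const_mul t).add_const a)).aestronglyMeasurable
    · exact Real.abs_cos_le_one _
  rw [charFun_apply_real, integral_map hX (by fun_prop), ← integral_complex_ofReal,
    ← integral_complex_ofReal, ← integral_mul_const, ← integral_add (hint _)
      ((hint _).mul_const _)]
  refine integral_congr_ae (ae_of_all _ fun ω => ?_)
  simp only [add_zero, ← sub_eq_add_neg, Real.cos_sub_pi_div_two]
  rw [← Complex.ofReal_mul, Complex.exp_mul_I, Complex.ofReal_cos, Complex.ofReal_sin]

/-- If `X_n`, `Y` are integrable real random variables with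
`d₃(X_n, Y) → 0`, then `X_n` converges to `Y` in distribution: for every bounded continuous
test function `f`, `E[f(X_n)] → E[f(Y)]`. -/
theorem d3_convergence_implies_weak_convergence
    {Ω : Type*} [MeasurableSpace Ω] (P : Measure Ω) [IsProbabilityMeasure P]
    (X : ℕ → Ω → ℝ) (Y : Ω → ℝ)
    (hX : ∀ n, Integrable (X n) P) (hY : Integrable Y P)
    (hconv : Tendsto (fun n => d3 P P (X n) Y) atTop (𝓝 0)) :
    ∀ f : BoundedContinuousFunction ℝ ℝ,
      Tendsto (fun n => ∫ ω, f (X n ω) ∂P) atTop (𝓝 (∫ ω, f (Y ω) ∂P)) := by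
  have hXm n : AEMeasurable (X n) P := (hX n).aemeasurable
  have hYm : AEMeasurable Y P := hY.aemeasurable
  let μ : ℕ → ProbabilityMeasure ℝ :=
    fun n => ⟨P.map (X n), Measure.isProbabilityMeasure_map (hXm n)⟩
  let ν : ProbabilityMeasure ℝ := ⟨P.map Y, Measure.isProbabilityMeasure_map hYm⟩
  have hweak : Tendsto μ atTop (𝓝 ν) := by
    refine ProbabilityMeasure.tendsto_iff_tendsto_charFun.2 fun t => ?_
    simp only [μ, ν, ProbabilityMeasure.coe_mk, charFun_map_eq_integral_cos (hXm _),
      charFun_map_eq_integral_cos hYm]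
    have hcos (a : ℝ) := (Complex.continuous_ofReal.tendsto _).comp
      (tendsto_integral_cos_of_tendsto_d3 hX hY hconv t a)
    exact (hcos _).add ((hcos _).mul_const _)
  intro f
  have hf := ProbabilityMeasure.tendsto_iff_forall_integral_tendsto.1 hweak f
  simpa only [μ, ν, ProbabilityMeasure.coe_mk,
    integral_map (hXm _) f.continuous.aestronglyMeasurable,
    integral_map hYm f.continuous.aestronglyMeasurable] using hf
end
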